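/- Let H_1, ..., H_n ⊆ R^k be symmetric slabs, i.e., sets of the form {x : |⟨x, θ_i⟩| ≤ 1} for some θ_i ∈ R^k. Then Vol_k(B^k ∩ ∩_{i=1}^n H_i) / Vol_k(B^k) ≥ c^k · ∏_{i=1}^n γ_k(√k · H_i), where c > 0 is an absolute constant and γ_k is the standard Gaussian measure on R^k. -/

import Mathlib

open MeasureTheory Real Metric
open scoped InnerProductSpace ENNReal Pointwise

/-- The standard Gaussian probability measure on `ℝᵏ`. -/
noncomputable def stdGaussian (k : ℕ) : Measure (EuclideanSpace ℝ (Fin k)) :=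
  volume.withDensity (fun y => ENNReal.ofReal ((2 * π) ^ (-(k : ℝ) / 2) * Real.exp (-‖y‖ ^ 2 / 2)))

/-- The one-dimensional Brunn–Minkowski inequality for nonempty compact sets. -/
lemma volume_add_volume_le_of_isCompact {K L C : Set ℝ} (hK : IsCompact K) (hL : IsCompact L)
    (hK0 : K.Nonempty) (hL0 : L.Nonempty) (h : ∀ x ∈ K, ∀ y ∈ L, x + y ∈ C) :
    volume K + volume L ≤ volume C := by
  obtain ⟨p, hp⟩ := hK.exists_isGreatest hK0
  obtain ⟨q, hq⟩ := hL.exists_isLeast hL0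
  have hd : AEDisjoint volume ((fun x => x + q) '' K) ((fun y => p + y) '' L) := by
    refine measure_mono_null (t := {p + q}) ?_ (by simp)
    rintro _ ⟨⟨x, hx, rfl⟩, ⟨y, hy, hxy⟩⟩
    have h1 := hp.2 hx
    have h2 := hq.2 hy
    simp only at hxy
    simp only [Set.mem_singleton_iff]
    linarith
  have hL' : MeasurableSet ((fun y => p + y) '' L) :=
    (hL.image (by fun_prop)).measurableSet
  calc volume K + volume L
      = volume ((fun x => x + q) '' K) + volume ((fun y => p + y) '' L) := by
        rw [Set.image_add_right, Set.image_add_left, measure_preimage_add_right,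
          measure_preimage_add]
    _ = volume ((fun x => x + q) '' K ∪ (fun y => p + y) '' L) :=
        (measure_union₀ hL'.nullMeasurableSet hd).symm
    _ ≤ volume C := by
        refine measure_mono (Set.union_subset ?_ ?_)
        · rintro _ ⟨x, hx, rfl⟩
          exact h x hx q hq.1
        · rintro _ ⟨y, hy, rfl⟩
          exact h p hp.1 y hy

/-- The one-dimensional Brunn–Minkowski inequality for nonempty measurable sets. -/
lemma volume_add_volume_le {A B C : Set ℝ} (hA : MeasurableSet A) (hB : MeasurableSet B)
    (hA0 : A.Nonempty) (hB0 : B.Nonempty) (h : ∀ x ∈ A, ∀ y ∈ B, x + y ∈ C) :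
    volume A + volume B ≤ volume C := by
  obtain ⟨a, ha⟩ := hA0
  obtain ⟨b, hb⟩ := hB0
  rw [hA.measure_eq_iSup_isCompact, hB.measure_eq_iSup_isCompact]
  simp only [iSup_and']
  refine ENNReal.biSup_add_biSup_le' ⟨∅, by simp⟩ ⟨∅, by simp⟩ fun K hK L hL => ?_
  refine (add_le_add (measure_mono (Set.subset_insert a K))
    (measure_mono (Set.subset_insert b L))).trans ?_
  refine volume_add_volume_le_of_isCompact (hK.2.insert a) (hL.2.insert b)
    (Set.insert_nonempty _ _) (Set.insert_nonempty _ _) fun x hx y hy => h x ?_ y ?_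
  · exact Set.insert_subset ha hK.1 hx
  · exact Set.insert_subset hb hL.1 hy

lemma ENNReal.rpow_mul_rpow_le_add (x y : ℝ≥0∞) {a b : ℝ} (ha : 0 < a) (hb : 0 < b)
    (hab : a + b = 1) :
    x ^ a * y ^ b ≤ ENNReal.ofReal a * x + ENNReal.ofReal b * y := by
  rcases eq_or_ne x ∞ with rfl | hx
  · rw [ENNReal.mul_top (by simpa using ha)]
    simp
  rcases eq_or_ne y ∞ with rfl | hy
  · rw [ENNReal.mul_top (by simpa using hb)]
    simp
  lift x to NNReal using hx
  lift y to NNReal using hy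
  have := NNReal.geom_mean_le_arith_mean2_weighted ⟨a, ha.le⟩ ⟨b, hb.le⟩ x y
    (by ext; exact hab)
  rw [← ENNReal.coe_rpow_of_nonneg _ ha.le, ← ENNReal.coe_rpow_of_nonneg _ hb.le,
    ENNReal.ofReal_eq_coe_nnreal ha.le, ENNReal.ofReal_eq_coe_nnreal hb.le]
  exact_mod_cast this

lemma ENNReal.rpow_mul_rpow_self (x : ℝ≥0∞) {a b : ℝ} (ha : 0 < a) (hb : 0 < b)
    (hab : a + b = 1) : x ^ a * x ^ b = x := by
  rw [← ENNReal.rpow_add_of_nonneg _ _ ha.le hb.le, hab, ENNReal.rpow_one]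

lemma lintegral_eq_lintegral_volume_lt {f : ℝ → ℝ≥0∞} (hf : Measurable f) (h : ∀ x, f x ≤ 1) :
    ∫⁻ x, f x = ∫⁻ t in Set.Ioi (0 : ℝ), volume {x | ENNReal.ofReal t < f x} := by
  have hfin : ∀ x, f x ≠ ∞ := fun x => ((h x).trans_lt ENNReal.one_lt_top).ne
  calc ∫⁻ x, f x = ∫⁻ x, ENNReal.ofReal (f x).toReal := by
        simp [ENNReal.ofReal_toReal (hfin _)]
    _ = ∫⁻ t in Set.Ioi (0 : ℝ), volume {x | t < (f x).toReal} :=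
        lintegral_eq_lintegral_meas_lt _ (.of_forall fun _ => ENNReal.toReal_nonneg)
          hf.ennreal_toReal.aemeasurable
    _ = _ := by
        refine setLIntegral_congr_fun measurableSet_Ioi fun t ht => ?_
        simp only [ENNReal.ofReal_lt_iff_lt_toReal (le_of_lt ht) (hfin _)]

/-- The Prékopa–Leindler inequality on `ℝ`, for functions of supremum one. -/
lemma prekopa_leindler_of_iSup_eq_one {f g h : ℝ → ℝ≥0∞} (hf : Measurable f) (hg : Measurable g)
    (hh : Measurable h) {a b : ℝ} (ha : 0 < a) (hb : 0 < b) (hab : a + b = 1)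
    (hf1 : ⨆ x, f x = 1) (hg1 : ⨆ x, g x = 1)
    (H : ∀ x y, f x ^ a * g y ^ b ≤ h (a * x + b * y)) :
    (∫⁻ x, f x) ^ a * (∫⁻ x, g x) ^ b ≤ ∫⁻ x, h x := by
  have hfle : ∀ x, f x ≤ 1 := fun x => (le_iSup f x).trans hf1.le
  have hgle : ∀ x, g x ≤ 1 := fun x => (le_iSup g x).trans hg1.le
  have hm : Measurable fun x => min (h x) 1 := hh.min measurable_const
  refine (ENNReal.rpow_mul_rpow_le_add _ _ ha hb hab).trans ?_
  refine le_trans ?_ (lintegral_mono fun x => min_le_left (h x) 1)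
  rw [lintegral_eq_lintegral_volume_lt hf hfle, lintegral_eq_lintegral_volume_lt hg hgle,
    lintegral_eq_lintegral_volume_lt hm fun x => min_le_right _ _,
    ← lintegral_const_mul' _ _ ENNReal.ofReal_ne_top,
    ← lintegral_const_mul' _ _ ENNReal.ofReal_ne_top]
  have hanti : Measurable fun t : ℝ => ENNReal.ofReal a * volume {x | ENNReal.ofReal t < f x} := by
    refine Measurable.const_mul (Antitone.measurable fun s t hst => measure_mono fun x hx => ?_) _
    exact (ENNReal.ofReal_le_ofReal hst).trans_lt hx
  rw [← lintegral_add_left hanti]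
  refine lintegral_mono fun t => ?_
  rcases lt_or_ge (ENNReal.ofReal t) 1 with ht | ht
  · have key : ∀ {c : ℝ}, 0 < c → ∀ s : Set ℝ, ENNReal.ofReal c * volume s = volume (c • s) := by
      intro c hc s
      simp [Measure.addHaar_smul, abs_of_pos hc]
    rw [key ha, key hb]
    obtain ⟨x, hx⟩ := lt_iSup_iff.1 (ht.trans_le hf1.ge)
    obtain ⟨y, hy⟩ := lt_iSup_iff.1 (ht.trans_le hg1.ge)
    refine volume_add_volume_le ((measurableSet_lt measurable_const hf).const_smul₀ a)
      ((measurableSet_lt measurable_const hg).const_smul₀ b)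
      (Set.Nonempty.smul_set ⟨x, hx⟩) (Set.Nonempty.smul_set ⟨y, hy⟩) ?_
    rintro _ ⟨x, hx, rfl⟩ _ ⟨y, hy, rfl⟩
    refine lt_min (lt_of_lt_of_le ?_ (H x y)) ht
    calc ENNReal.ofReal t = ENNReal.ofReal t ^ a * ENNReal.ofReal t ^ b :=
          (ENNReal.rpow_mul_rpow_self _ ha hb hab).symm
      _ < f x ^ a * g y ^ b :=
          ENNReal.mul_lt_mul (ENNReal.rpow_lt_rpow hx ha) (ENNReal.rpow_lt_rpow hy hb)
  · have h1 : {x | ENNReal.ofReal t < f x} = ∅ :=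
      Set.eq_empty_of_forall_notMem fun x hx => ((hfle x).trans ht).not_gt hx
    have h2 : {x | ENNReal.ofReal t < g x} = ∅ :=
      Set.eq_empty_of_forall_notMem fun x hx => ((hgle x).trans ht).not_gt hx
    simp [h1, h2]

/-- The Prékopa–Leindler inequality on `ℝ`, for bounded functions. -/
lemma prekopa_leindler_of_bounded {f g h : ℝ → ℝ≥0∞} (hf : Measurable f) (hg : Measurable g)
    (hh : Measurable h) {a b : ℝ} (ha : 0 < a) (hb : 0 < b) (hab : a + b = 1)
    (hf1 : ⨆ x, f x ≠ ∞) (hg1 : ⨆ x, g x ≠ ∞)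
    (H : ∀ x y, f x ^ a * g y ^ b ≤ h (a * x + b * y)) :
    (∫⁻ x, f x) ^ a * (∫⁻ x, g x) ^ b ≤ ∫⁻ x, h x := by
  set F := ⨆ x, f x with hF
  set G := ⨆ x, g x with hG
  rcases eq_or_ne F 0 with hF0 | hF0
  · have : ∀ x, f x = 0 := by simpa [hF] using hF0
    simp [this, ha]
  rcases eq_or_ne G 0 with hG0 | hG0
  · have : ∀ x, g x = 0 := by simpa [hG] using hG0
    simp [this, hb]
  have hFa : F ^ a ≠ 0 := (ENNReal.rpow_pos (pos_iff_ne_zero.2 hF0) hf1).ne'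
  have hGb : G ^ b ≠ 0 := (ENNReal.rpow_pos (pos_iff_ne_zero.2 hG0) hg1).ne'
  have hFa' : F ^ a ≠ ∞ := ENNReal.rpow_ne_top_of_nonneg ha.le hf1
  have hGb' : G ^ b ≠ ∞ := ENNReal.rpow_ne_top_of_nonneg hb.le hg1
  have hinv : (F⁻¹) ^ a * (G⁻¹) ^ b = (F ^ a * G ^ b)⁻¹ := by
    rw [ENNReal.inv_rpow, ENNReal.inv_rpow, ENNReal.mul_inv (.inl hFa) (.inl hFa')]
  have := prekopa_leindler_of_iSup_eq_one (f := fun x => F⁻¹ * f x) (g := fun x => G⁻¹ * g x)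
    (h := fun x => (F ^ a * G ^ b)⁻¹ * h x) (hf.const_mul _) (hg.const_mul _) (hh.const_mul _)
    ha hb hab (by rw [← ENNReal.mul_iSup, ← hF, ENNReal.inv_mul_cancel hF0 hf1])
    (by rw [← ENNReal.mul_iSup, ← hG, ENNReal.inv_mul_cancel hG0 hg1]) fun x y => by
      rw [ENNReal.mul_rpow_of_nonneg _ _ ha.le, ENNReal.mul_rpow_of_nonneg _ _ hb.le,
        mul_mul_mul_comm, hinv]
      gcongr
      exact H x y
  rw [lintegral_const_mul _ hf, lintegral_const_mul _ hg, lintegral_const_mul _ hh,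
    ENNReal.mul_rpow_of_nonneg _ _ ha.le, ENNReal.mul_rpow_of_nonneg _ _ hb.le,
    mul_mul_mul_comm, hinv] at this
  have h0 : (F ^ a * G ^ b)⁻¹ ≠ 0 := ENNReal.inv_ne_zero.2 (ENNReal.mul_ne_top hFa' hGb')
  have h1 : (F ^ a * G ^ b)⁻¹ ≠ ∞ := ENNReal.inv_ne_top.2 (mul_ne_zero hFa hGb)
  exact (ENNReal.mul_le_mul_iff_right h0 h1).1 this

lemma iSup_lintegral_min_natCast {f : ℝ → ℝ≥0∞} (hf : Measurable f) :
    ⨆ n : ℕ, ∫⁻ x, min (f x) n = ∫⁻ x, f x := by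
  rw [← lintegral_iSup (fun n => hf.min measurable_const)
    fun m n hmn x => min_le_min_left _ (by exact_mod_cast hmn)]
  refine lintegral_congr fun x => ?_
  change ⨆ n : ℕ, f x ⊓ (n : ℝ≥0∞) = f x
  rw [← inf_iSup_eq, ENNReal.iSup_natCast, inf_top_eq]

/-- The Prékopa–Leindler inequality on `ℝ`. -/
lemma prekopa_leindler_real {f g h : ℝ → ℝ≥0∞} (hf : Measurable f) (hg : Measurable g)
    (hh : Measurable h) {a b : ℝ} (ha : 0 < a) (hb : 0 < b) (hab : a + b = 1)
    (H : ∀ x y, f x ^ a * g y ^ b ≤ h (a * x + b * y)) :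
    (∫⁻ x, f x) ^ a * (∫⁻ x, g x) ^ b ≤ ∫⁻ x, h x := by
  have hlim : ∀ {u : ℝ → ℝ≥0∞}, Measurable u →
      Filter.Tendsto (fun n : ℕ => ∫⁻ x, min (u x) n) Filter.atTop (nhds (∫⁻ x, u x)) := by
    intro u hu
    rw [← iSup_lintegral_min_natCast hu]
    exact tendsto_atTop_iSup fun m n hmn =>
      lintegral_mono fun x => min_le_min_left _ (by exact_mod_cast hmn)
  have hbd : ∀ n : ℕ, (∫⁻ x, min (f x) n) ^ a * (∫⁻ x, min (g x) n) ^ b ≤ ∫⁻ x, h x := by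
    intro n
    refine prekopa_leindler_of_bounded (hf.min measurable_const) (hg.min measurable_const) hh
      ha hb hab ?_ ?_ fun x y => le_trans ?_ (H x y)
    · exact ((iSup_le fun x => min_le_right _ _).trans_lt (ENNReal.natCast_lt_top n)).ne
    · exact ((iSup_le fun x => min_le_right _ _).trans_lt (ENNReal.natCast_lt_top n)).ne
    · gcongr <;> exact min_le_left _ _
  rcases eq_or_ne (∫⁻ x, f x) 0 with hf0 | hf0
  · simp [hf0, ha]
  rcases eq_or_ne (∫⁻ x, g x) 0 with hg0 | hg0
  · simp [hg0, hb]
  refine le_of_tendsto' (ENNReal.Tendsto.mul ((hlim hf).ennrpow_const a) (.inl ?_)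
    ((hlim hg).ennrpow_const b) (.inl ?_)) hbd
  · simp [ENNReal.rpow_eq_zero_iff, hf0, ha.le]
  · simp [ENNReal.rpow_eq_zero_iff, hg0, hb.le]

lemma measurable_finCons (m : ℕ) :
    Measurable fun p : ℝ × (Fin m → ℝ) => (Fin.cons p.1 p.2 : Fin (m + 1) → ℝ) := by
  refine measurable_pi_iff.2 fun i => Fin.cases ?_ (fun j => ?_) i
  · simpa using measurable_fst
  · simpa [Function.comp_def] using
      (measurable_pi_apply (X := fun _ : Fin m => ℝ) j).comp (measurable_snd (α := ℝ))

lemma lintegral_fin_succ {m : ℕ} {F : (Fin (m + 1) → ℝ) → ℝ≥0∞} (hF : Measurable F) :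
    ∫⁻ x, F x = ∫⁻ t : ℝ, ∫⁻ y : Fin m → ℝ, F (Fin.cons t y) := by
  have e := (volume_preserving_piFinSuccAbove (fun _ : Fin (m + 1) => ℝ) 0).symm
  have hcons : ∀ p, (MeasurableEquiv.piFinSuccAbove (fun _ : Fin (m + 1) => ℝ) 0).symm p =
      Fin.cons p.1 p.2 := fun p => by
    simp [MeasurableEquiv.piFinSuccAbove_symm_apply, Fin.consEquiv]
  rw [← e.lintegral_comp_emb (MeasurableEquiv.measurableEmbedding _), Measure.volume_eq_prod]
  simp only [hcons]
  exact lintegral_prod _ (hF.comp (measurable_finCons m)).aemeasurable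

/-- The Prékopa–Leindler inequality on `ℝᵐ`. -/
theorem prekopa_leindler {a b : ℝ} (ha : 0 < a) (hb : 0 < b) (hab : a + b = 1) (m : ℕ)
    {f g h : (Fin m → ℝ) → ℝ≥0∞} (hf : Measurable f) (hg : Measurable g) (hh : Measurable h)
    (H : ∀ x y, f x ^ a * g y ^ b ≤ h (a • x + b • y)) :
    (∫⁻ x, f x) ^ a * (∫⁻ x, g x) ^ b ≤ ∫⁻ x, h x := by
  induction m with
  | zero =>
    have hv : (volume : Measure (Fin 0 → ℝ)) Set.univ = 1 := by simp [volume_pi]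
    have hu : ∀ u : (Fin 0 → ℝ) → ℝ≥0∞, ∫⁻ x, u x = u 0 := fun u => by
      rw [lintegral_unique, hv, mul_one]
      exact congrArg u (Subsingleton.elim _ _)
    have h0 : a • (0 : Fin 0 → ℝ) + b • 0 = 0 := Subsingleton.elim _ _
    rw [hu, hu, hu]
    simpa only [h0] using H 0 0
  | succ m ih =>
    rw [lintegral_fin_succ hf, lintegral_fin_succ hg, lintegral_fin_succ hh]
    refine prekopa_leindler_real (hf.comp (measurable_finCons m)).lintegral_prod_right'
      (hg.comp (measurable_finCons m)).lintegral_prod_right'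
      (hh.comp (measurable_finCons m)).lintegral_prod_right' ha hb hab fun s t => ?_
    have hc : ∀ t : ℝ, Measurable fun y : Fin m → ℝ => (Fin.cons t y : Fin (m + 1) → ℝ) :=
      fun t => (measurable_finCons m).comp measurable_prodMk_left
    refine ih (hf.comp (hc s)) (hg.comp (hc t)) (hh.comp (hc _)) fun x y => ?_
    have hxy : (Fin.cons (a * s + b * t) (a • x + b • y) : Fin (m + 1) → ℝ) =
        a • Fin.cons s x + b • Fin.cons t y := by
      ext i
      refine Fin.cases ?_ (fun j => ?_) i <;> simp
    simpa only [Function.comp_apply, hxy] using H (Fin.cons s x) (Fin.cons t y)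

open ProbabilityTheory in
/-- The standard Gaussian density on `ℝᵐ`, in coordinates. -/
noncomputable def gaussianDensity (m : ℕ) (y : Fin m → ℝ) : ℝ≥0∞ := ∏ i, gaussianPDF 0 1 (y i)

lemma measurable_gaussianDensity (m : ℕ) : Measurable (gaussianDensity m) := by
  unfold gaussianDensity
  exact Finset.measurable_prod _ fun i _ =>
    (ProbabilityTheory.measurable_gaussianPDF 0 1).comp (measurable_pi_apply i)

lemma gaussianDensity_cons {m : ℕ} (t : ℝ) (y : Fin m → ℝ) :
    gaussianDensity (m + 1) (Fin.cons t y) =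
      ProbabilityTheory.gaussianPDF 0 1 t * gaussianDensity m y := by
  simp [gaussianDensity, Fin.prod_univ_succ]

lemma gaussianDensity_eq (m : ℕ) (y : Fin m → ℝ) :
    gaussianDensity m y =
      ENNReal.ofReal ((2 * π) ^ (-(m : ℝ) / 2) * Real.exp (-(∑ i, y i ^ 2) / 2)) := by
  have h1 : ((√(2 * π))⁻¹) ^ m = (2 * π) ^ (-(m : ℝ) / 2) := by
    rw [Real.sqrt_eq_rpow, ← Real.rpow_neg (by positivity), ← Real.rpow_natCast,
      ← Real.rpow_mul (by positivity)]
    congr 1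
    ring
  simp only [gaussianDensity, ProbabilityTheory.gaussianPDF]
  rw [← ENNReal.ofReal_prod_of_nonneg fun i _ => ProbabilityTheory.gaussianPDFReal_nonneg _ _ _]
  simp [ProbabilityTheory.gaussianPDFReal, Finset.prod_mul_distrib, ← Real.exp_sum,
    ← Finset.sum_div, ← h1]

lemma gaussianDensity_neg {m : ℕ} (y : Fin m → ℝ) :
    gaussianDensity m (-y) = gaussianDensity m y := by
  simp [gaussianDensity_eq]

lemma lintegral_gaussianDensity (m : ℕ) : ∫⁻ y, gaussianDensity m y = 1 := by
  induction m with
  | zero => simp [gaussianDensity, volume_pi]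
  | succ m ih =>
    rw [lintegral_fin_succ (measurable_gaussianDensity _)]
    simp_rw [gaussianDensity_cons, lintegral_const_mul _ (measurable_gaussianDensity m), ih,
      mul_one]
    exact ProbabilityTheory.lintegral_gaussianPDF_eq_one 0 one_ne_zero

/-- The Gaussian density is log-concave. -/
lemma gaussianDensity_rpow_mul_rpow_le {m : ℕ} {a b : ℝ} (ha : 0 < a) (hb : 0 < b)
    (hab : a + b = 1) (x y : Fin m → ℝ) :
    gaussianDensity m x ^ a * gaussianDensity m y ^ b ≤ gaussianDensity m (a • x + b • y) := by
  simp only [gaussianDensity_eq]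
  have hC : 0 < (2 * π) ^ (-(m : ℝ) / 2) := by positivity
  rw [ENNReal.ofReal_rpow_of_pos (by positivity), ENNReal.ofReal_rpow_of_pos (by positivity),
    ← ENNReal.ofReal_mul (by positivity)]
  refine ENNReal.ofReal_le_ofReal ?_
  rw [Real.mul_rpow hC.le (Real.exp_pos _).le, Real.mul_rpow hC.le (Real.exp_pos _).le,
    mul_mul_mul_comm, ← Real.rpow_add hC, hab, Real.rpow_one, ← Real.exp_mul, ← Real.exp_mul,
    ← Real.exp_add]
  refine mul_le_mul_of_nonneg_left (Real.exp_le_exp.2 ?_) hC.le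
  have : ∑ i, (a • x + b • y) i ^ 2 ≤ a * ∑ i, x i ^ 2 + b * ∑ i, y i ^ 2 := by
    rw [Finset.mul_sum, Finset.mul_sum, ← Finset.sum_add_distrib]
    refine Finset.sum_le_sum fun i _ => ?_
    obtain rfl : b = 1 - a := by linarith
    simp only [Pi.add_apply, Pi.smul_apply, smul_eq_mul]
    nlinarith [mul_nonneg (mul_pos ha hb).le (sq_nonneg (x i - y i))]
  linarith

/-- The Gaussian measure of the slice of `K` at height `t` in the first coordinate. -/
noncomputable def gaussianSlice {m : ℕ} (K : Set (Fin (m + 1) → ℝ)) (t : ℝ) : ℝ≥0∞ :=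
  ∫⁻ y : Fin m → ℝ, K.indicator (1 : (Fin (m + 1) → ℝ) → ℝ≥0∞) (Fin.cons t y : Fin (m + 1) → ℝ) * gaussianDensity m y

section Slice

variable {m : ℕ} {K : Set (Fin (m + 1) → ℝ)}

lemma measurable_indicator_cons_mul (hK : MeasurableSet K) :
    Measurable fun p : ℝ × (Fin m → ℝ) =>
      K.indicator (1 : (Fin (m + 1) → ℝ) → ℝ≥0∞) (Fin.cons p.1 p.2 : Fin (m + 1) → ℝ) * gaussianDensity m p.2 :=
  ((measurable_one.indicator hK).comp (measurable_finCons m)).mul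
    ((measurable_gaussianDensity m).comp measurable_snd)

lemma measurable_gaussianSlice (hK : MeasurableSet K) : Measurable (gaussianSlice K) :=
  (measurable_indicator_cons_mul hK).lintegral_prod_right'

lemma gaussianSlice_neg (hs : ∀ x ∈ K, -x ∈ K) (t : ℝ) :
    gaussianSlice K (-t) = gaussianSlice K t := by
  unfold gaussianSlice
  rw [← lintegral_neg_eq_self]
  refine lintegral_congr fun y => ?_
  have hcons : (Fin.cons (-t) (-y) : Fin (m + 1) → ℝ) = -Fin.cons t y := by
    ext i
    refine Fin.cases ?_ (fun j => ?_) i <;> simp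
  have hmem : -(Fin.cons t y : Fin (m + 1) → ℝ) ∈ K ↔ (Fin.cons t y : Fin (m + 1) → ℝ) ∈ K :=
    ⟨fun h => by simpa using hs _ h, hs _⟩
  rw [gaussianDensity_neg, hcons]
  by_cases h : (Fin.cons t y : Fin (m + 1) → ℝ) ∈ K
  · rw [Set.indicator_of_mem h, Set.indicator_of_mem (hmem.2 h)]
    rfl
  · rw [Set.indicator_of_notMem h, Set.indicator_of_notMem (mt hmem.1 h)]

/-- Central slices of a symmetric convex set have the largest Gaussian measure. -/
lemma gaussianSlice_le (hK : MeasurableSet K) (hc : Convex ℝ K) (hs : ∀ x ∈ K, -x ∈ K)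
    {s t : ℝ} (hst : |s| ≤ |t|) : gaussianSlice K t ≤ gaussianSlice K s := by
  rcases hst.eq_or_lt with h | h
  · rcases abs_eq_abs.1 h with rfl | rfl
    · rfl
    · rw [gaussianSlice_neg hs]
  have ht : t ≠ 0 := by
    rintro rfl
    simp at h
    exact absurd h (abs_nonneg s).not_gt
  have hq : |s / t| < 1 := by rwa [abs_div, div_lt_one (abs_pos.2 ht)]
  obtain ⟨hq1, hq2⟩ := abs_lt.1 hq
  set a := (1 + s / t) / 2 with ha_def
  set b := (1 - s / t) / 2 with hb_def
  have ha : 0 < a := by rw [ha_def]; linarith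
  have hb : 0 < b := by rw [hb_def]; linarith
  have hab : a + b = 1 := by rw [ha_def, hb_def]; ring
  have habt : a * t + b * (-t) = s := by rw [ha_def, hb_def]; field_simp; ring
  have hm : ∀ r : ℝ, Measurable fun y : Fin m → ℝ =>
      K.indicator (1 : (Fin (m + 1) → ℝ) → ℝ≥0∞) (Fin.cons r y : Fin (m + 1) → ℝ) * gaussianDensity m y :=
    fun r => (measurable_indicator_cons_mul hK).comp measurable_prodMk_left
  have key := prekopa_leindler ha hb hab m (hm t) (hm (-t)) (hm s) fun x y => ?_
  · change gaussianSlice K t ^ a * gaussianSlice K (-t) ^ b ≤ gaussianSlice K s at key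
    rwa [gaussianSlice_neg hs, ENNReal.rpow_mul_rpow_self _ ha hb hab] at key
  by_cases hx : (Fin.cons t x : Fin (m + 1) → ℝ) ∈ K
  swap
  · simp [Set.indicator_of_notMem hx, ha]
  by_cases hy : (Fin.cons (-t) y : Fin (m + 1) → ℝ) ∈ K
  swap
  · simp [Set.indicator_of_notMem hy, hb]
  have hxy : (Fin.cons s (a • x + b • y) : Fin (m + 1) → ℝ) =
      a • Fin.cons t x + b • Fin.cons (-t) y := by
    rw [← habt]
    ext i
    refine Fin.cases ?_ (fun j => ?_) i <;> simp
  have hmem : (Fin.cons s (a • x + b • y) : Fin (m + 1) → ℝ) ∈ K := by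
    rw [hxy]
    exact hc hx hy ha.le hb.le hab
  simpa [Set.indicator_of_mem hx, Set.indicator_of_mem hy, Set.indicator_of_mem hmem] using
    gaussianDensity_rpow_mul_rpow_le ha hb hab x y

lemma withDensity_gaussianDensity_inter (hK : MeasurableSet K) {A : Set ℝ}
    (hA : MeasurableSet A) :
    volume.withDensity (gaussianDensity (m + 1)) (K ∩ {x | x 0 ∈ A}) =
      ∫⁻ t in A, gaussianSlice K t ∂ProbabilityTheory.gaussianReal 0 1 := by
  have hA' : MeasurableSet {x : Fin (m + 1) → ℝ | x 0 ∈ A} := measurable_pi_apply 0 hA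
  rw [withDensity_apply _ (hK.inter hA'), ← lintegral_indicator (hK.inter hA'),
    lintegral_fin_succ ((measurable_gaussianDensity _).indicator (hK.inter hA')),
    ProbabilityTheory.gaussianReal_of_var_ne_zero _ one_ne_zero,
    setLIntegral_withDensity_eq_setLIntegral_mul _ (ProbabilityTheory.measurable_gaussianPDF 0 1)
      (measurable_gaussianSlice hK) hA, ← lintegral_indicator hA]
  refine lintegral_congr fun t => ?_
  by_cases ht : t ∈ A
  · rw [Set.indicator_of_mem ht, Pi.mul_apply, gaussianSlice, ← lintegral_const_mul' _ _
      ProbabilityTheory.gaussianPDF_ne_top]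
    refine lintegral_congr fun y => ?_
    by_cases hy : (Fin.cons t y : Fin (m + 1) → ℝ) ∈ K
    · rw [Set.indicator_of_mem (by exact ⟨hy, ht⟩), Set.indicator_of_mem hy, gaussianDensity_cons]
      simp
    · rw [Set.indicator_of_notMem (fun h => hy h.1), Set.indicator_of_notMem hy]
      simp
  · rw [Set.indicator_of_notMem ht]
    have hy : ∀ y : Fin m → ℝ, (Fin.cons t y : Fin (m + 1) → ℝ) ∉ K ∩ {x | x 0 ∈ A} :=
      fun y h => ht h.2
    simp [Set.indicator_of_notMem (hy _)]

end Slice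

/-- Chebyshev's association inequality for a function decreasing in `|t|` and a symmetric
interval. -/
lemma lintegral_mul_measure_le_setLIntegral (ν : Measure ℝ) [IsProbabilityMeasure ν]
    {φ : ℝ → ℝ≥0∞} (hφ : ∀ s t, |s| ≤ |t| → φ t ≤ φ s) {r : ℝ} (hr : 0 ≤ r) :
    (∫⁻ t, φ t ∂ν) * ν {t | |t| ≤ r} ≤ ∫⁻ t in {t | |t| ≤ r}, φ t ∂ν := by
  set A := {t : ℝ | |t| ≤ r} with hAdef
  have hA : MeasurableSet A := measurableSet_le (by fun_prop) measurable_const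
  have h1 : φ r * ν A ≤ ∫⁻ t in A, φ t ∂ν := by
    rw [← setLIntegral_const]
    exact setLIntegral_mono' hA fun t ht => hφ _ _ (by rwa [abs_of_nonneg hr])
  have h2 : ∫⁻ t in Aᶜ, φ t ∂ν ≤ φ r * ν Aᶜ := by
    rw [← setLIntegral_const]
    refine setLIntegral_mono' hA.compl fun t ht => hφ _ _ ?_
    rw [abs_of_nonneg hr]
    have ht' : ¬ |t| ≤ r := ht
    exact (not_le.1 ht').le
  calc (∫⁻ t, φ t ∂ν) * ν A
      = (∫⁻ t in A, φ t ∂ν) * ν A + (∫⁻ t in Aᶜ, φ t ∂ν) * ν A := by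
        rw [← lintegral_add_compl _ hA, add_mul]
    _ ≤ (∫⁻ t in A, φ t ∂ν) * ν A + (φ r * ν Aᶜ) * ν A := by gcongr
    _ = (∫⁻ t in A, φ t ∂ν) * ν A + (φ r * ν A) * ν Aᶜ := by rw [mul_right_comm]
    _ ≤ (∫⁻ t in A, φ t ∂ν) * ν A + (∫⁻ t in A, φ t ∂ν) * ν Aᶜ := by gcongr
    _ = ∫⁻ t in A, φ t ∂ν := by rw [← mul_add, prob_add_prob_compl hA, mul_one]

/-- Šidák's inequality for a coordinate slab. -/
lemma withDensity_gaussianDensity_mul_le {m : ℕ} {K : Set (Fin (m + 1) → ℝ)}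
    (hK : MeasurableSet K) (hc : Convex ℝ K) (hs : ∀ x ∈ K, -x ∈ K) {r : ℝ} (hr : 0 ≤ r) :
    volume.withDensity (gaussianDensity (m + 1)) K *
        volume.withDensity (gaussianDensity (m + 1)) {x | |x 0| ≤ r} ≤
      volume.withDensity (gaussianDensity (m + 1)) (K ∩ {x | |x 0| ≤ r}) := by
  have hA : MeasurableSet {t : ℝ | |t| ≤ r} := measurableSet_le (by fun_prop) measurable_const
  have h1 := withDensity_gaussianDensity_inter hK hA
  have h2 := withDensity_gaussianDensity_inter hK MeasurableSet.univ
  have h3 := withDensity_gaussianDensity_inter (m := m) MeasurableSet.univ hA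
  simp only [Set.mem_ofPred_eq, Set.mem_univ, Set.ofPred_true, Set.inter_univ, Set.univ_inter,
    Measure.restrict_univ] at h1 h2 h3
  have h4 : ∀ t, gaussianSlice (Set.univ : Set (Fin (m + 1) → ℝ)) t = 1 := fun t => by
    simp [gaussianSlice, lintegral_gaussianDensity]
  rw [h1, h2, h3]
  simp only [h4, lintegral_one, Measure.restrict_apply_univ]
  exact lintegral_mul_measure_le_setLIntegral _ (fun s t => gaussianSlice_le hK hc hs) hr

lemma stdGaussian_apply_eq {k : ℕ} (b : OrthonormalBasis (Fin k) ℝ (EuclideanSpace ℝ (Fin k)))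
    {S : Set (EuclideanSpace ℝ (Fin k))} (hS : MeasurableSet S) :
    stdGaussian k S = volume.withDensity (gaussianDensity k)
      ((fun y : Fin k → ℝ => b.repr.symm (WithLp.toLp 2 y)) ⁻¹' S) := by
  have hL : MeasurePreserving fun y : Fin k → ℝ => b.repr.symm (WithLp.toLp 2 y) :=
    b.measurePreserving_repr_symm.comp (PiLp.volume_preserving_toLp (Fin k))
  rw [stdGaussian, withDensity_apply _ hS, withDensity_apply _ (hL.measurable hS),
    ← hL.setLIntegral_comp_preimage hS (by fun_prop)]
  refine lintegral_congr fun y => ?_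
  simp [gaussianDensity_eq, EuclideanSpace.norm_sq_eq]

instance (k : ℕ) : IsProbabilityMeasure (stdGaussian k) := ⟨by
  rw [stdGaussian_apply_eq (EuclideanSpace.basisFun (Fin k) ℝ) MeasurableSet.univ]
  simp [lintegral_gaussianDensity]⟩

lemma measurableSet_slab {k : ℕ} (θ : EuclideanSpace ℝ (Fin k)) (r : ℝ) :
    MeasurableSet {x | |⟪x, θ⟫_ℝ| ≤ r} :=
  measurableSet_le (by fun_prop) measurable_const

/-- Šidák's inequality for the standard Gaussian measure. -/
lemma stdGaussian_mul_slab_le {k : ℕ} {K : Set (EuclideanSpace ℝ (Fin k))}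
    (hK : MeasurableSet K) (hc : Convex ℝ K) (hs : ∀ x ∈ K, -x ∈ K)
    (θ : EuclideanSpace ℝ (Fin k)) {r : ℝ} (hr : 0 ≤ r) :
    stdGaussian k K * stdGaussian k {x | |⟪x, θ⟫_ℝ| ≤ r} ≤
      stdGaussian k (K ∩ {x | |⟪x, θ⟫_ℝ| ≤ r}) := by
  rcases eq_or_ne θ 0 with rfl | hθ
  · simp [hr]
  obtain ⟨m, rfl⟩ : ∃ m, k = m + 1 := by
    rcases k with - | m
    · exact absurd (Subsingleton.elim θ 0) hθ
    · exact ⟨m, rfl⟩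
  have hθ' : 0 < ‖θ‖ := norm_pos_iff.2 hθ
  obtain ⟨b, hb⟩ := Orthonormal.exists_orthonormalBasis_extension_of_card_eq (𝕜 := ℝ)
    (E := EuclideanSpace ℝ (Fin (m + 1))) (ι := Fin (m + 1)) (by simp)
    (v := fun _ => ‖θ‖⁻¹ • θ) (s := {0}) (by
      refine ⟨fun i => ?_, fun i j hij => absurd (Subsingleton.elim i j) hij⟩
      simp [norm_smul, hθ'.ne'])
  have hθb : θ = ‖θ‖ • b 0 := by
    rw [hb 0 rfl, smul_smul, mul_inv_cancel₀ hθ'.ne', one_smul]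
  have hpre : (fun y : Fin (m + 1) → ℝ => b.repr.symm (WithLp.toLp 2 y)) ⁻¹'
      {x | |⟪x, θ⟫_ℝ| ≤ r} = {y | |y 0| ≤ r / ‖θ‖} := by
    ext y
    have : ⟪b.repr.symm (WithLp.toLp 2 y), θ⟫_ℝ = ‖θ‖ * y 0 := by
      rw [hθb, inner_smul_right, real_inner_comm, ← b.repr_apply_apply, ← hθb]
      simp
    simp only [Set.mem_preimage, Set.mem_ofPred_eq, this, abs_mul, abs_norm, le_div_iff₀' hθ']
  have hH := measurableSet_slab θ r
  let L : (Fin (m + 1) → ℝ) →ₗ[ℝ] EuclideanSpace ℝ (Fin (m + 1)) :=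
    b.repr.symm.toLinearEquiv.toLinearMap ∘ₗ (WithLp.linearEquiv 2 ℝ _).symm.toLinearMap
  have hLm : Measurable L := L.continuous_of_finiteDimensional.measurable
  rw [stdGaussian_apply_eq b hK, stdGaussian_apply_eq b hH, stdGaussian_apply_eq b (hK.inter hH),
    Set.preimage_inter, hpre]
  refine withDensity_gaussianDensity_mul_le (hLm hK) (hc.linear_preimage L) (fun x hx => ?_)
    (by positivity)
  have := hs _ hx
  change L (-x) ∈ K
  rw [map_neg]
  exact this

/-- The Khatri–Šidák inequality for a symmetric convex set and finitely many symmetric slabs. -/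
lemma stdGaussian_mul_prod_slab_le {k : ℕ} {K : Set (EuclideanSpace ℝ (Fin k))}
    (hK : MeasurableSet K) (hc : Convex ℝ K) (hs : ∀ x ∈ K, -x ∈ K) {r : ℝ} (hr : 0 ≤ r)
    {ι : Type*} (I : Finset ι) (θ : ι → EuclideanSpace ℝ (Fin k)) :
    stdGaussian k K * ∏ i ∈ I, stdGaussian k {x | |⟪x, θ i⟫_ℝ| ≤ r} ≤
      stdGaussian k (K ∩ ⋂ i ∈ I, {x | |⟪x, θ i⟫_ℝ| ≤ r}) := by
  classical
  have hslab : ∀ i, {x | |⟪x, θ i⟫_ℝ| ≤ r} = (innerₗ _ (θ i)) ⁻¹' Set.Icc (-r) r := fun i => by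
    ext x
    simp [abs_le, real_inner_comm]
  induction I using Finset.induction_on with
  | empty => simp
  | insert i I hi ih =>
    rw [Finset.prod_insert hi, mul_left_comm, mul_comm, Finset.set_biInter_insert,
      Set.inter_left_comm, Set.inter_comm {x | |⟪x, θ i⟫_ℝ| ≤ r}]
    refine (mul_le_mul_left ih _).trans (stdGaussian_mul_slab_le ?_ ?_ ?_ (θ i) hr)
    · exact hK.inter (I.measurableSet_biInter fun i _ => measurableSet_slab _ _)
    · refine hc.inter (convex_iInter₂ fun j _ => ?_)
      rw [hslab]
      exact (convex_Icc _ _).linear_preimage _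
    · rintro x ⟨hx, hx'⟩
      exact ⟨hs x hx, by simpa using hx'⟩


lemma stdGaussian_le_mul_volume (k : ℕ) {S : Set (EuclideanSpace ℝ (Fin k))}
    (hS : MeasurableSet S) :
    stdGaussian k S ≤ ENNReal.ofReal ((2 * π) ^ (-(k : ℝ) / 2)) * volume S := by
  rw [stdGaussian, withDensity_apply _ hS, ← setLIntegral_const]
  refine lintegral_mono fun y => ENNReal.ofReal_le_ofReal ?_
  refine mul_le_of_le_one_right (by positivity) (Real.exp_le_one_iff.2 ?_)
  have := sq_nonneg ‖y‖
  linarith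

lemma mul_volume_closedBall_le_stdGaussian (k : ℕ) :
    ENNReal.ofReal ((2 * π) ^ (-(k : ℝ) / 2) * Real.exp (-1 / 2) ^ k) *
        volume (closedBall (0 : EuclideanSpace ℝ (Fin k)) √k) ≤
      stdGaussian k (closedBall 0 √k) := by
  rw [stdGaussian, withDensity_apply _ measurableSet_closedBall, ← setLIntegral_const]
  refine setLIntegral_mono' measurableSet_closedBall fun y hy => ENNReal.ofReal_le_ofReal ?_
  refine mul_le_mul_of_nonneg_left ?_ (by positivity)
  rw [← Real.exp_nat_mul]
  refine Real.exp_le_exp.2 ?_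
  have h1 : ‖y‖ ≤ √k := by simpa using hy
  have h2 : ‖y‖ ^ 2 ≤ (k : ℝ) := by
    calc ‖y‖ ^ 2 ≤ √(k : ℝ) ^ 2 := by gcongr
      _ = (k : ℝ) := Real.sq_sqrt (by positivity)
  linarith

lemma smul_slab {k : ℕ} (θ : EuclideanSpace ℝ (Fin k)) {s : ℝ} (hs : 0 < s) :
    s • {x | |⟪x, θ⟫_ℝ| ≤ 1} = {x | |⟪x, θ⟫_ℝ| ≤ s} := by
  ext x
  rw [Set.mem_smul_set_iff_inv_smul_mem₀ hs.ne']
  simp only [Set.mem_ofPred_eq, real_inner_smul_left, abs_mul, abs_inv, abs_of_pos hs]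
  rw [inv_mul_le_iff₀ hs, mul_one]

/-- For symmetric slabs `H₁, …, Hₙ ⊆ ℝᵏ`,
`Vol(Bᵏ ∩ ⋂ Hᵢ) ≥ cᵏ · ∏ γₖ(√k Hᵢ) · Vol(Bᵏ)` for an absolute constant `c > 0`. -/
theorem stmt_6 :
    ∃ c : ℝ, 0 < c ∧ ∀ (k n : ℕ) (θ : Fin n → EuclideanSpace ℝ (Fin k))
      (H : Fin n → Set (EuclideanSpace ℝ (Fin k))),
      (∀ i, H i = {x | |⟪x, θ i⟫_ℝ| ≤ 1}) →
      ENNReal.ofReal (c ^ k) * (∏ i, stdGaussian k (Real.sqrt k • H i)) *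
          volume (closedBall (0 : EuclideanSpace ℝ (Fin k)) 1) ≤
        volume (closedBall (0 : EuclideanSpace ℝ (Fin k)) 1 ∩ ⋂ i, H i) := by
  refine ⟨Real.exp (-1 / 2), Real.exp_pos _, fun k n θ H hH => ?_⟩
  rcases Nat.eq_zero_or_pos k with rfl | hk
  · have hH' : ∀ i, H i = Set.univ := fun i => by
      rw [hH]
      refine Set.eq_univ_of_forall fun x => ?_
      simp [Subsingleton.elim x 0]
    simp only [hH', Set.iInter_univ, Set.inter_univ, pow_zero, ENNReal.ofReal_one, one_mul]
    exact mul_le_of_le_one_left zero_le (Finset.prod_le_one' fun i _ => prob_le_one)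
  have hs : 0 < √(k : ℝ) := Real.sqrt_pos.2 (by exact_mod_cast hk)
  set P := ∏ i, stdGaussian k (√(k : ℝ) • H i) with hP
  have hball : closedBall (0 : EuclideanSpace ℝ (Fin k)) √k = √(k : ℝ) • closedBall 0 1 := by
    simp [_root_.smul_closedBall (√(k : ℝ)) _ zero_le_one, abs_of_pos hs]
  have hscale : ∀ S : Set (EuclideanSpace ℝ (Fin k)),
      volume (√(k : ℝ) • S) = ENNReal.ofReal (√(k : ℝ) ^ k) * volume S := fun S => by
    rw [Measure.addHaar_smul, finrank_euclideanSpace_fin, abs_of_pos (by positivity)]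
  have hinter : closedBall (0 : EuclideanSpace ℝ (Fin k)) √k ∩
      ⋂ i ∈ Finset.univ, {x | |⟪x, θ i⟫_ℝ| ≤ √k} = √(k : ℝ) • (closedBall 0 1 ∩ ⋂ i, H i) := by
    rw [Set.smul_set_inter₀ hs.ne', ← hball, ← Set.preimage_smul_inv₀ hs.ne' (⋂ i, H i),
      Set.preimage_iInter]
    simp only [Set.preimage_smul_inv₀ hs.ne', hH, smul_slab _ hs, Finset.mem_univ, Set.iInter_true]
  have hmain := stdGaussian_mul_prod_slab_le
    (measurableSet_closedBall (x := (0 : EuclideanSpace ℝ (Fin k))) (ε := √k))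
    (convex_closedBall _ _) (fun x hx => by simpa using hx) hs.le Finset.univ θ
  have hPθ : ∏ i, stdGaussian k {x | |⟪x, θ i⟫_ℝ| ≤ √k} = P := by
    simp only [hP, hH, smul_slab _ hs]
  have hmeas : MeasurableSet (closedBall (0 : EuclideanSpace ℝ (Fin k)) √k ∩
      ⋂ i ∈ Finset.univ, {x | |⟪x, θ i⟫_ℝ| ≤ √k}) :=
    measurableSet_closedBall.inter
      (Finset.univ.measurableSet_biInter fun i _ => measurableSet_slab _ _)
  have hchain := (mul_le_mul_left (mul_volume_closedBall_le_stdGaussian k) P).trans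
    ((hPθ ▸ hmain).trans (stdGaussian_le_mul_volume k hmeas))
  rw [hinter, hball, hscale, hscale, ENNReal.ofReal_mul (by positivity)] at hchain
  have hD0 : ENNReal.ofReal ((2 * π) ^ (-(k : ℝ) / 2)) * ENNReal.ofReal (√(k : ℝ) ^ k) ≠ 0 :=
    mul_ne_zero (ENNReal.ofReal_pos.2 (by positivity)).ne'
      (ENNReal.ofReal_pos.2 (by positivity)).ne'
  have hD1 : ENNReal.ofReal ((2 * π) ^ (-(k : ℝ) / 2)) * ENNReal.ofReal (√(k : ℝ) ^ k) ≠ ∞ :=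
    ENNReal.mul_ne_top ENNReal.ofReal_ne_top ENNReal.ofReal_ne_top
  refine (ENNReal.mul_le_mul_iff_right hD0 hD1).1 ?_
  calc _ = _ := by ring
    _ ≤ _ := hchain
    _ = _ := by ring
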